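/- arXiv:1707.02187 — 5 statements merged into one kernel-verified Lean document; each statement's English description precedes it below -/
import Mathlib

section
/- Let n and x be positive integers with x ≤ n. Then F_n(x, ⌊n/(n−x+1)⌋) > 0, and F_n(x,k) = 0 for every k < ⌊n/(n−x+1)⌋; that is, ⌊n/(n−x+1)⌋ is the smallest value of k for which F_n(x,k) > 0. -/
/-- Longest run of consecutive zeros (`false`) in a binary string. -/
def longestZeroRun (l : List Bool) : ℕ :=
  Nat.findGreatest (fun k => List.replicate k false <:+: l) l.length

/-- `F n x k`: the number of binary strings of length `n` with exactly `x` zeros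
whose longest run of consecutive zeros has length exactly `k`. -/
def F (n x k : ℕ) : ℕ :=
  (Finset.univ.filter (fun s : Fin n → Bool =>
    (List.ofFn s).count false = x ∧ longestZeroRun (List.ofFn s) = k)).card

theorem replicate_infix_of_le {a b : ℕ} (h : a ≤ b) {l : List Bool}
    (hb : List.replicate b false <:+: l) : List.replicate a false <:+: l := by
  refine List.IsInfix.trans (List.IsPrefix.isInfix ⟨List.replicate (b - a) false, ?_⟩) hb
  rw [List.replicate_append_replicate, Nat.add_sub_cancel' h]

theorem longestZeroRun_eq {l : List Bool} {k : ℕ} (hk : List.replicate k false <:+: l)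
    (hk' : ¬ List.replicate (k + 1) false <:+: l) : longestZeroRun l = k := by
  have hle : k ≤ l.length := by simpa using hk.length_le
  refine le_antisymm ?_ (Nat.le_findGreatest hle hk)
  by_contra! h
  exact hk' (replicate_infix_of_le h
    (Nat.findGreatest_spec (P := fun k => List.replicate k false <:+: l) hle hk))

theorem not_replicate_longestZeroRun_succ_infix (l : List Bool) :
    ¬ List.replicate (longestZeroRun l + 1) false <:+: l := by
  intro h
  have hle : longestZeroRun l + 1 ≤ l.length := by simpa using h.length_le
  exact Nat.findGreatest_is_greatest (Nat.lt_succ_self _) hle h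

theorem replicate_infix_append_true_cons {k : ℕ} (j : ℕ) {l : List Bool}
    (hj : j ≤ k) (h : List.replicate (k + 1) false <:+: List.replicate j false ++ true :: l) :
    List.replicate (k + 1) false <:+: l := by
  induction j with
  | zero =>
    rw [List.replicate_zero, List.nil_append, List.infix_cons_iff] at h
    refine h.resolve_left fun h => ?_
    simp [List.replicate_succ] at h
  | succ j ih =>
    rw [List.replicate_succ (n := j), List.cons_append, List.infix_cons_iff] at h
    refine ih (by omega) (h.resolve_left fun h => ?_)
    rw [← List.cons_append, ← List.replicate_succ] at h
    have := h.getElem (i := j + 1) (by simp; omega)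
    simp at this

theorem count_false_le {k : ℕ} (l : List Bool) (j : ℕ)
    (h : ¬ List.replicate (k + 1) false <:+: List.replicate j false ++ l) :
    j + l.count false ≤ k * (l.count true + 1) := by
  induction l generalizing j with
  | nil =>
    by_contra! hj
    exact h (replicate_infix_of_le (b := j) (by simp at hj; omega) (by simp))
  | cons b l ih =>
    cases b with
    | false =>
      have := ih (j + 1) (by simpa [List.replicate_succ'] using h)
      simp
      omega
    | true =>
      have hj : j ≤ k := by
        by_contra! hj
        exact h (replicate_infix_of_le (b := j) hj (List.prefix_append _ _).isInfix)
      have := ih 0 fun h' => h (h'.trans ⟨List.replicate j false ++ [true], [], by simp⟩)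
      simp
      linarith

/-- The string `tail`, preceded by `m` copies of `0^a 1`. -/
def zeroBlocks (a : ℕ) (tail : List Bool) : ℕ → List Bool
  | 0 => tail
  | m + 1 => List.replicate a false ++ true :: zeroBlocks a tail m

theorem length_zeroBlocks (a : ℕ) (tail : List Bool) (m : ℕ) :
    (zeroBlocks a tail m).length = m * (a + 1) + tail.length := by
  induction m with
  | zero => simp [zeroBlocks]
  | succ m ih => simp [zeroBlocks, ih]; ring

theorem count_false_zeroBlocks (a : ℕ) (tail : List Bool) (m : ℕ) :
    (zeroBlocks a tail m).count false = m * a + tail.count false := by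
  induction m with
  | zero => simp [zeroBlocks]
  | succ m ih => simp [zeroBlocks, ih]; ring

theorem suffix_zeroBlocks (a : ℕ) (tail : List Bool) (m : ℕ) :
    tail <:+ zeroBlocks a tail m := by
  induction m with
  | zero => exact List.suffix_refl _
  | succ m ih => exact ih.trans ⟨List.replicate a false ++ [true], by simp [zeroBlocks]⟩

theorem replicate_infix_of_zeroBlocks {a k : ℕ} (ha : a ≤ k) {tail : List Bool} (m : ℕ)
    (h : List.replicate (k + 1) false <:+: zeroBlocks a tail m) :
    List.replicate (k + 1) false <:+: tail := by
  induction m with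
  | zero => exact h
  | succ m ih => exact ih (replicate_infix_append_true_cons a ha h)

theorem F_pos_of_list (l : List Bool) :
    0 < F l.length (l.count false) (longestZeroRun l) :=
  Finset.card_pos.2 ⟨fun i => l[i], by simp⟩

/-- For `0 < x ≤ n`, the smallest `k` with `F n x k > 0` is `⌊n / (n - x + 1)⌋`. -/
theorem F_least_k (n x : ℕ) (hn : 0 < n) (hx : 0 < x) (hxn : x ≤ n) :
    0 < F n x (n / (n - x + 1)) ∧ ∀ k, k < n / (n - x + 1) → F n x k = 0 := by
  obtain ⟨m, rfl⟩ := Nat.exists_eq_add_of_le' hxn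
  rw [Nat.add_sub_cancel]
  constructor
  · have hq : 0 < (m + x) / (m + 1) := Nat.div_pos (by omega) (by omega)
    have hr : (m + x) % (m + 1) < m + 1 := Nat.mod_lt _ (by omega)
    have hdiv := Nat.div_add_mod (m + x) (m + 1)
    generalize (m + x) / (m + 1) = q at *
    generalize (m + x) % (m + 1) = r at *
    obtain ⟨p, rfl⟩ : ∃ p, q = p + 1 := ⟨q - 1, by omega⟩
    obtain ⟨d, rfl⟩ : ∃ d, m = r + d := ⟨m - r, by omega⟩
    let l := zeroBlocks p (zeroBlocks (p + 1) (List.replicate (p + 1) false) r) d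
    have hlen : l.length = r + d + x := by
      simp only [l, length_zeroBlocks, List.length_replicate]
      linarith
    have hcount : l.count false = x := by
      simp only [l, count_false_zeroBlocks, List.count_replicate_self]
      linarith
    have hrun : longestZeroRun l = p + 1 := by
      refine longestZeroRun_eq
        ((suffix_zeroBlocks _ _ r).trans (suffix_zeroBlocks _ _ d)).isInfix fun h => ?_
      have := (replicate_infix_of_zeroBlocks le_rfl r
        (replicate_infix_of_zeroBlocks (Nat.le_succ p) d h)).length_le
      simp at this
    simpa only [hlen, hcount, hrun] using F_pos_of_list l
  · intro k hk
    refine Finset.card_eq_zero.2 (Finset.filter_eq_empty_iff.2 ?_)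
    rintro s - ⟨hcount, rfl⟩
    have hle := count_false_le (List.ofFn s) 0
      (not_replicate_longestZeroRun_succ_infix (List.ofFn s))
    have hlen := List.count_false_add_count_true (List.ofFn s)
    rw [hcount, List.length_ofFn] at hlen
    rw [hcount, show (List.ofFn s).count true = m by omega] at hle
    refine hk.not_ge (Nat.lt_succ_iff.1 ((Nat.div_lt_iff_lt_mul (by omega)).2 ?_))
    rw [Nat.succ_mul]
    omega
end

section
/- For every positive integer n, the number of pairs (x,k) of natural numbers with k ≤ x ≤ n and F_n(x,k) > 0 equals C(n+2, 2) − Σ_{i=0}^{n} ⌊n/(i+1)⌋. -/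
open List in
theorem longestZeroRun_eq_iff (l : List Bool) (k : ℕ) :
    longestZeroRun l = k ↔
      replicate k false <:+: l ∧ ¬ replicate (k + 1) false <:+: l := by
  unfold longestZeroRun
  rw [Nat.findGreatest_eq_iff]
  constructor
  · rintro ⟨h₁, h₂, h₃⟩
    refine ⟨?_, fun h => ?_⟩
    · rcases Nat.eq_zero_or_pos k with rfl | hk
      · simp
      · exact h₂ hk.ne'
    · have hlen := h.length_le
      rw [length_replicate] at hlen
      exact h₃ (Nat.lt_succ_self k) hlen h
  · rintro ⟨h₁, h₂⟩
    refine ⟨by simpa using h₁.length_le, fun _ => h₁, fun m hm _ h => h₂ ?_⟩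
    refine IsInfix.trans (IsPrefix.isInfix ⟨replicate (m - (k + 1)) false, ?_⟩) h
    rw [replicate_append_replicate]
    congr 1
    omega

open List in
theorem add_count_false_le_of_not_replicate_isInfix (k : ℕ) (l : List Bool) (j : ℕ)
    (h : ¬ replicate (k + 1) false <:+: replicate j false ++ l) :
    j + l.count false ≤ k * (l.count true + 1) := by
  have hj : j ≤ k := by
    by_contra! hjk
    refine h (IsPrefix.isInfix ⟨replicate (j - (k + 1)) false ++ l, ?_⟩)
    rw [← append_assoc, replicate_append_replicate]
    congr 2
    omega
  induction l generalizing j with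
  | nil => simpa using hj
  | cons b l ih =>
    cases b with
    | false =>
      have h' : ¬ replicate (k + 1) false <:+: replicate (j + 1) false ++ l := by
        rw [replicate_succ' (n := j), append_assoc]
        exact h
      have hj' : j + 1 ≤ k := by
        by_contra! hjk
        refine h' (IsPrefix.isInfix ⟨l, ?_⟩)
        congr 2
        omega
      have := ih (j + 1) h' hj'
      simp only [count_cons_self, count_cons_of_ne (by decide : false ≠ true)]
      omega
    | true =>
      have h' : ¬ replicate (k + 1) false <:+: replicate 0 false ++ l := fun hi =>
        h (hi.trans ⟨replicate j false ++ [true], [], by simp⟩)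
      have := ih 0 h' (Nat.zero_le k)
      simp only [count_cons_self, count_cons_of_ne (by decide : true ≠ false)]
      rw [mul_add k (l.count true + 1) 1]
      omega

open List in
theorem le_of_replicate_isPrefix (a j : ℕ) (l : List Bool)
    (h : replicate a false <+: replicate j false ++ true :: l) : a ≤ j := by
  induction j generalizing a with
  | zero =>
    cases a with
    | zero => rfl
    | succ a => simp [replicate_succ] at h
  | succ j ih =>
    cases a with
    | zero => omega
    | succ a =>
      simp only [replicate_succ, cons_append, cons_prefix_cons, true_and] at h
      exact Nat.succ_le_succ (ih a h)

open List in
theorem not_replicate_isInfix_append (k j : ℕ) (l : List Bool) (hj : j ≤ k)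
    (h : ¬ replicate (k + 1) false <:+: l) :
    ¬ replicate (k + 1) false <:+: replicate j false ++ true :: l := by
  induction j with
  | zero =>
    rw [replicate_zero, nil_append, infix_cons_iff]
    rintro (hp | hi)
    · have := le_of_replicate_isPrefix (k + 1) 0 l hp
      omega
    · exact h hi
  | succ j ih =>
    intro hi
    have hi' := hi
    rw [replicate_succ (n := j), cons_append, infix_cons_iff] at hi'
    rcases hi' with hp | hi'
    · rw [← cons_append, ← replicate_succ] at hp
      have := le_of_replicate_isPrefix (k + 1) (j + 1) l hp
      omega
    · exact ih (by omega) hi'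

open List in
theorem exists_list_longestZeroRun_eq (k m x : ℕ) (h₁ : k ≤ x) (h₂ : x ≤ k * (m + 1)) :
    ∃ l : List Bool, l.count false = x ∧ l.count true = m ∧ longestZeroRun l = k := by
  simp only [longestZeroRun_eq_iff]
  induction m generalizing x with
  | zero =>
    obtain rfl : x = k := by omega
    refine ⟨replicate x false, by simp, by simp [count_replicate], infix_rfl, fun h => ?_⟩
    have := h.length_le
    simp at this
  | succ m ih =>
    rw [mul_add k (m + 1) 1] at h₂
    have hk : k ≤ k * (m + 1) := Nat.le_mul_of_pos_right k (Nat.succ_pos m)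
    obtain ⟨l, hf, ht, hi, hn⟩ :=
      ih (min x (k * (m + 1))) (le_min h₁ hk) (min_le_right _ _)
    refine ⟨replicate (x - min x (k * (m + 1))) false ++ true :: l, ?_, ?_, ?_, ?_⟩
    · simp only [count_append, count_replicate_self,
        count_cons_of_ne (by decide : true ≠ false), hf]
      omega
    · simp [count_append, count_replicate, ht]
    · exact hi.trans ⟨replicate (x - min x (k * (m + 1))) false ++ [true], [], by simp⟩
    · exact not_replicate_isInfix_append k _ l (by omega) hn

theorem F_pos_iff_exists_list (n x k : ℕ) :
    0 < F n x k ↔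
      ∃ l : List Bool, l.length = n ∧ l.count false = x ∧ longestZeroRun l = k := by
  unfold F
  rw [Finset.card_pos]
  constructor
  · rintro ⟨s, hs⟩
    rw [Finset.mem_filter] at hs
    exact ⟨List.ofFn s, List.length_ofFn, hs.2⟩
  · rintro ⟨l, rfl, h⟩
    refine ⟨l.get, ?_⟩
    rw [Finset.mem_filter, List.ofFn_get]
    exact ⟨Finset.mem_univ _, h⟩

theorem F_pos_iff (n x k : ℕ) (hkx : k ≤ x) (hxn : x ≤ n) :
    0 < F n x k ↔ x ≤ k * (n - x + 1) := by
  rw [F_pos_iff_exists_list]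
  constructor
  · rintro ⟨l, hl, hx, hk⟩
    have h := add_count_false_le_of_not_replicate_isInfix k l 0
      (by simpa using ((longestZeroRun_eq_iff l k).1 hk).2)
    have hc := List.count_false_add_count_true l
    have ht : l.count true = n - x := by omega
    rw [ht] at h
    omega
  · intro h
    obtain ⟨l, hf, ht, hk⟩ := exists_list_longestZeroRun_eq k (n - x) x hkx h
    have hc := List.count_false_add_count_true l
    exact ⟨l, by omega, hf, hk⟩

theorem le_mul_sub_add_one_iff (n x k : ℕ) (hxn : x ≤ n) :
    x ≤ k * (n - x + 1) ↔ x < n + 1 - n / (k + 1) := by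
  obtain ⟨m, rfl⟩ := Nat.exists_eq_add_of_le hxn
  rw [Nat.add_sub_cancel_left]
  have hd : (x + m) / (k + 1) < m + 1 ↔ x + m < (m + 1) * (k + 1) :=
    Nat.div_lt_iff_lt_mul (Nat.succ_pos k)
  have he : (m + 1) * (k + 1) = k * (m + 1) + (m + 1) := by ring
  omega

theorem div_succ_le_sub (n k : ℕ) (hk : k ≤ n) : n / (k + 1) ≤ n + 1 - k := by
  obtain ⟨m, rfl⟩ := Nat.exists_eq_add_of_le hk
  have h : (k + m) / (k + 1) < m + 2 := by
    rw [Nat.div_lt_iff_lt_mul (Nat.succ_pos k)]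
    nlinarith [Nat.zero_le (m * k)]
  omega

theorem sum_range_succ_sub_eq_choose (n : ℕ) :
    ∑ k ∈ Finset.range (n + 1), (n + 1 - k) = (n + 2).choose 2 := by
  induction n with
  | zero => rfl
  | succ n ih =>
    rw [Finset.sum_range_succ', Nat.choose_succ_succ' (n + 2) 1, ← ih, Nat.choose_one_right]
    simp only [Nat.add_sub_add_right, Nat.sub_zero]
    omega

/-- The number of pairs `(x, k)` with `k ≤ x ≤ n` and `F n x k > 0` equals
`C(n+2, 2) - ∑_{i=0}^{n} ⌊n/(i+1)⌋`. -/
theorem card_S (n : ℕ) (hn : 0 < n) :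
    ((Finset.Iic n ×ˢ Finset.Iic n).filter
        (fun p : ℕ × ℕ => p.2 ≤ p.1 ∧ 0 < F n p.1 p.2)).card
      = (n + 2).choose 2 - ∑ i ∈ Finset.range (n + 1), n / (i + 1) := by
  have hfiber : ∀ k ∈ Finset.range (n + 1),
      (((Finset.Iic n ×ˢ Finset.Iic n).filter
        (fun p : ℕ × ℕ => p.2 ≤ p.1 ∧ 0 < F n p.1 p.2)).filter (fun p => p.2 = k)).card
        = (n + 1 - k) - n / (k + 1) := by
    intro k hk
    rw [Finset.mem_range] at hk
    have himage : ((Finset.Iic n ×ˢ Finset.Iic n).filter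
        (fun p : ℕ × ℕ => p.2 ≤ p.1 ∧ 0 < F n p.1 p.2)).filter (fun p => p.2 = k)
        = Finset.Ico k (n + 1 - n / (k + 1)) ×ˢ {k} := by
      ext ⟨x, j⟩
      simp only [Finset.mem_filter, Finset.mem_product, Finset.mem_Iic, Finset.mem_Ico,
        Finset.mem_singleton]
      constructor
      · rintro ⟨⟨⟨hx, -⟩, hjx, hF⟩, rfl⟩
        rw [F_pos_iff n x j hjx hx, le_mul_sub_add_one_iff n x j hx] at hF
        exact ⟨⟨hjx, hF⟩, rfl⟩
      · rintro ⟨⟨hjx, hF⟩, rfl⟩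
        have hx : x ≤ n := Nat.lt_succ_iff.1 (hF.trans_le (Nat.sub_le _ _))
        rw [← le_mul_sub_add_one_iff n x j hx, ← F_pos_iff n x j hjx hx] at hF
        exact ⟨⟨⟨hx, by omega⟩, hjx, hF⟩, rfl⟩
    rw [himage, Finset.card_product, Nat.card_Ico, Finset.card_singleton]
    omega
  rw [Finset.card_eq_sum_card_fiberwise (f := Prod.snd) (t := Finset.range (n + 1)),
    Finset.sum_congr rfl hfiber, ← sum_range_succ_sub_eq_choose]
  · exact Finset.sum_tsub_distrib _ fun k hk =>
      div_succ_le_sub n k (by rw [Finset.mem_range] at hk; omega)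
  · intro p hp
    simp only [Finset.coe_filter, Finset.mem_product, Finset.mem_Iic, Set.mem_ofPred_eq] at hp
    simp only [Finset.coe_range, Set.mem_Iio]
    omega
end

section
/- For all natural numbers n and x with 3 ≤ x ≤ n and n ≥ 3, F_n(x, x−1) = (n−x)(n−x+1). -/
/-- The set of positions of the zeros (`false`) of a binary string. -/
def zeroPositions {n : ℕ} (s : Fin n → Bool) : Finset ℕ :=
  (Finset.univ.filter (fun i => s i = false)).map Fin.valEmbedding

theorem mem_zeroPositions {n : ℕ} {s : Fin n → Bool} {t : ℕ} :
    t ∈ zeroPositions s ↔ ∃ h : t < n, s ⟨t, h⟩ = false := by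
  simp only [zeroPositions, Finset.mem_map, Finset.mem_filter, Finset.mem_univ, true_and,
    Fin.valEmbedding_apply]
  constructor
  · rintro ⟨i, hi, rfl⟩
    exact ⟨i.2, hi⟩
  · rintro ⟨h, hs⟩
    exact ⟨⟨t, h⟩, hs, rfl⟩

theorem card_zeroPositions {n : ℕ} (s : Fin n → Bool) :
    (zeroPositions s).card = (List.ofFn s).count false := by
  rw [zeroPositions, Finset.card_map]
  induction n with
  | zero => simp
  | succ n ih =>
    rw [Fin.card_filter_univ_succ, List.ofFn_succ, List.count_cons, ← ih]
    cases h : s 0 <;> simp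

theorem replicate_false_infix_ofFn_iff {n k : ℕ} {s : Fin n → Bool} :
    List.replicate k false <:+: List.ofFn s ↔
      ∃ a, Finset.Ico a (a + k) ⊆ zeroPositions s := by
  rw [List.infix_iff_getElem?]
  simp only [List.length_replicate, List.length_ofFn, List.getElem_replicate]
  constructor
  · rintro ⟨a, ha, h⟩
    refine ⟨a, fun t ht => ?_⟩
    rw [Finset.mem_Ico] at ht
    have := h (t - a) (by omega)
    rw [Nat.sub_add_cancel ht.1, List.getElem?_eq_some_iff] at this
    obtain ⟨h₁, h₂⟩ := this
    rw [mem_zeroPositions]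
    exact ⟨by omega, by simpa using h₂⟩
  · rintro ⟨a, h⟩
    rcases Nat.eq_zero_or_pos k with rfl | hk
    · exact ⟨0, by simp⟩
    have hmem (i : ℕ) (hi : i < k) :=
      mem_zeroPositions.1 (h (Finset.mem_Ico.2 (show a ≤ i + a ∧ i + a < a + k by omega)))
    obtain ⟨hlast, -⟩ := hmem (k - 1) (by omega)
    refine ⟨a, by omega, fun i hi => ?_⟩
    obtain ⟨h₁, h₂⟩ := hmem i hi
    rw [List.getElem?_eq_some_iff]
    exact ⟨by simpa using h₁, by simpa using h₂⟩

theorem longestZeroRun_ofFn_eq_iff {n k : ℕ} {s : Fin n → Bool} :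
    longestZeroRun (List.ofFn s) = k ↔
      (∃ a, Finset.Ico a (a + k) ⊆ zeroPositions s) ∧
        ∀ a, ¬ Finset.Ico a (a + (k + 1)) ⊆ zeroPositions s := by
  simp only [← not_exists, ← replicate_false_infix_ofFn_iff]
  rw [longestZeroRun, Nat.findGreatest_eq_iff]
  constructor
  · rintro ⟨-, h, h'⟩
    refine ⟨?_, fun hinf => ?_⟩
    · rcases eq_or_ne k 0 with rfl | hk
      · simp
      · exact h hk
    · exact h' k.lt_succ_self (by simpa using hinf.length_le) hinf
  · rintro ⟨h, h'⟩
    refine ⟨by simpa using h.length_le, fun _ => h, fun m hm _ hinf => h' ?_⟩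
    refine List.IsInfix.trans ?_ hinf
    exact ⟨[], List.replicate (m - (k + 1)) false, by
      rw [List.nil_append, List.replicate_append_replicate, Nat.add_sub_cancel' hm]⟩

open scoped Classical in
theorem F_eq_card_powerset_filter (n x k : ℕ) :
    F n x k = ((Finset.range n).powerset.filter (fun Z : Finset ℕ => Z.card = x ∧
      (∃ a, Finset.Ico a (a + k) ⊆ Z) ∧ ∀ a, ¬ Finset.Ico a (a + (k + 1)) ⊆ Z)).card := by
  refine Finset.card_bij (fun s _ => zeroPositions s) ?_ ?_ ?_
  · intro s hs
    rw [Finset.mem_filter, longestZeroRun_ofFn_eq_iff, ← card_zeroPositions] at hs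
    rw [Finset.mem_filter, Finset.mem_powerset]
    exact ⟨fun t ht => Finset.mem_range.2 (mem_zeroPositions.1 ht).1, hs.2⟩
  · intro s _ s' _ h
    funext i
    have := congrArg ((i : ℕ) ∈ ·) h
    simp only [mem_zeroPositions, i.2, exists_true_left, Fin.eta, eq_iff_iff] at this
    cases hs : s i <;> cases hs' : s' i <;> simp_all
  · intro Z hZ
    rw [Finset.mem_filter, Finset.mem_powerset] at hZ
    have hz : zeroPositions (fun t : Fin n => decide ((t : ℕ) ∉ Z)) = Z := by
      ext t
      have := @hZ.1 t
      simp only [Finset.mem_range] at this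
      simpa [mem_zeroPositions] using this
    refine ⟨_, ?_, hz⟩
    rw [Finset.mem_filter, longestZeroRun_ofFn_eq_iff, ← card_zeroPositions, hz]
    exact ⟨Finset.mem_univ _, hZ.2⟩

/-- The zero set with a run of `k` zeros preceded by `i` ones, and one more zero preceded
by `j` ones. -/
def runAndPoint (k i j : ℕ) : Finset ℕ :=
  if i < j then insert (j + k) (Finset.Ico i (i + k))
  else insert j (Finset.Ico (i + 1) (i + 1 + k))

theorem mem_runAndPoint {k i j t : ℕ} :
    t ∈ runAndPoint k i j ↔
      (i < j ∧ (t = j + k ∨ i ≤ t ∧ t < i + k)) ∨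
        (j ≤ i ∧ (t = j ∨ i + 1 ≤ t ∧ t < i + 1 + k)) := by
  unfold runAndPoint
  split_ifs <;> simp only [Finset.mem_insert, Finset.mem_Ico] <;> omega

theorem card_runAndPoint (k i j : ℕ) : (runAndPoint k i j).card = k + 1 := by
  unfold runAndPoint
  split_ifs <;> rw [Finset.card_insert_of_notMem (by rw [Finset.mem_Ico]; omega)] <;> simp

theorem exists_Ico_subset_runAndPoint (k i j : ℕ) :
    ∃ a, Finset.Ico a (a + k) ⊆ runAndPoint k i j := by
  unfold runAndPoint
  split_ifs
  · exact ⟨i, Finset.subset_insert _ _⟩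
  · exact ⟨i + 1, Finset.subset_insert _ _⟩

theorem not_Ico_subset_runAndPoint {k i j : ℕ} (hk : 2 ≤ k) (hij : i ≠ j) (a : ℕ) :
    ¬ Finset.Ico a (a + (k + 1)) ⊆ runAndPoint k i j := by
  intro h
  have hmem (t : ℕ) (ht : a ≤ t ∧ t < a + (k + 1)) :=
    mem_runAndPoint.1 (h (Finset.mem_Ico.2 ht))
  have h₀ := hmem a (by omega)
  have h₁ := hmem (a + 1) (by omega)
  have h₂ := hmem (a + k - 1) (by omega)
  have h₃ := hmem (a + k) (by omega)
  omega

theorem le_of_insert_Ico_eq {k p q a b : ℕ} (hk : 2 ≤ k) (hb : q + 1 ≠ b)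
    (h : insert p (Finset.Ico a (a + k)) = insert q (Finset.Ico b (b + k))) : b ≤ a := by
  have hmem (t : ℕ) (ht : a ≤ t ∧ t < a + k) : t = q ∨ b ≤ t ∧ t < b + k := by
    have : t ∈ insert q (Finset.Ico b (b + k)) :=
      h ▸ Finset.mem_insert_of_mem (Finset.mem_Ico.2 ht)
    simpa using this
  have h₀ := hmem a (by omega)
  have h₁ := hmem (a + 1) (by omega)
  omega

theorem insert_Ico_injective {k p q a b : ℕ} (hk : 2 ≤ k) (ha : p + 1 ≠ a) (hb : q + 1 ≠ b)
    (hp : ¬ (a ≤ p ∧ p < a + k))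
    (h : insert p (Finset.Ico a (a + k)) = insert q (Finset.Ico b (b + k))) :
    a = b ∧ p = q := by
  obtain rfl : a = b :=
    le_antisymm (le_of_insert_Ico_eq hk ha h.symm) (le_of_insert_Ico_eq hk hb h)
  have hpq : p ∈ insert q (Finset.Ico a (a + k)) := h ▸ Finset.mem_insert_self _ _
  rw [Finset.mem_insert, Finset.mem_Ico] at hpq
  exact ⟨rfl, hpq.resolve_right hp⟩

theorem runAndPoint_injective {k i j i' j' : ℕ} (hk : 2 ≤ k) (hij : i ≠ j) (hij' : i' ≠ j')
    (h : runAndPoint k i j = runAndPoint k i' j') : i = i' ∧ j = j' := by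
  unfold runAndPoint at h
  split_ifs at h <;>
    have := insert_Ico_injective hk (by omega) (by omega) (by omega) h <;> omega

theorem exists_eq_runAndPoint {m k : ℕ} {Z : Finset ℕ} (hk : 0 < k)
    (hZ : Z ⊆ Finset.range (m + k + 1)) (hcard : Z.card = k + 1)
    (hrun : ∃ a, Finset.Ico a (a + k) ⊆ Z)
    (hmax : ∀ a, ¬ Finset.Ico a (a + (k + 1)) ⊆ Z) :
    ∃ i j, i ≤ m ∧ j ≤ m ∧ i ≠ j ∧ runAndPoint k i j = Z := by
  obtain ⟨a, ha⟩ := hrun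
  have hdiff : (Z \ Finset.Ico a (a + k)).card = 1 := by
    rw [Finset.card_sdiff_of_subset ha, Nat.card_Ico]
    omega
  obtain ⟨b, hb⟩ := Finset.card_eq_one.1 hdiff
  have hmem (t : ℕ) : t ∈ Z ↔ t = b ∨ a ≤ t ∧ t < a + k := by
    have h₁ := congrArg (t ∈ ·) hb
    have h₂ := @ha t
    simp only [Finset.mem_sdiff, Finset.mem_Ico, Finset.mem_singleton, eq_iff_iff] at h₁ h₂
    tauto
  have hb' : ¬ (a ≤ b ∧ b < a + k) := by
    have : b ∈ Z \ Finset.Ico a (a + k) := by simp [hb]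
    simpa using (Finset.mem_sdiff.1 this).2
  have hright : b ≠ a + k := fun h => hmax a fun t ht => by
    rw [Finset.mem_Ico] at ht
    rw [hmem]
    omega
  have hleft : b + 1 ≠ a := fun h => hmax b fun t ht => by
    rw [Finset.mem_Ico] at ht
    rw [hmem]
    omega
  have hbn := Finset.mem_range.1 (hZ ((hmem b).2 (Or.inl rfl)))
  have han := Finset.mem_range.1 (hZ ((hmem (a + k - 1)).2 (by omega)))
  rcases lt_or_ge b a with hlt | hge
  · refine ⟨a - 1, b, by omega, by omega, by omega, ?_⟩
    ext t
    rw [mem_runAndPoint, hmem]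
    omega
  · refine ⟨a, b - k, by omega, by omega, by omega, ?_⟩
    ext t
    rw [mem_runAndPoint, hmem]
    omega

/-- For `3 ≤ x ≤ n`, `F n x (x-1) = (n-x)(n-x+1)`. -/
theorem F_x_xsub1 (n x : ℕ) (hn : 3 ≤ n) (hx : 3 ≤ x) (hxn : x ≤ n) :
    F n x (x - 1) = (n - x) * (n - x + 1) := by
  obtain ⟨k, rfl⟩ : ∃ k, x = k + 1 := ⟨x - 1, by omega⟩
  obtain ⟨m, rfl⟩ : ∃ m, n = m + k + 1 := ⟨n - (k + 1), by omega⟩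
  have hm : m + k + 1 - (k + 1) = m := by omega
  classical
  rw [hm, Nat.add_sub_cancel, F_eq_card_powerset_filter]
  have hoff : (Finset.range (m + 1)).offDiag.card = m * (m + 1) := by
    rw [Finset.offDiag_card, Finset.card_range, ← Nat.sub_one_mul, Nat.add_sub_cancel]
  rw [← hoff]
  symm
  refine Finset.card_bij (fun (p : ℕ × ℕ) _ => runAndPoint k p.1 p.2) ?_ ?_ ?_
  · rintro ⟨i, j⟩ hp
    simp only [Finset.mem_offDiag, Finset.mem_range] at hp
    rw [Finset.mem_filter, Finset.mem_powerset]
    refine ⟨fun t ht => ?_, card_runAndPoint k i j, exists_Ico_subset_runAndPoint k i j,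
      not_Ico_subset_runAndPoint (by omega) hp.2.2⟩
    rw [mem_runAndPoint] at ht
    rw [Finset.mem_range]
    omega
  · rintro ⟨i, j⟩ hp ⟨i', j'⟩ hp' h
    rw [Finset.mem_offDiag] at hp hp'
    rw [Prod.mk.injEq]
    exact runAndPoint_injective (by omega) hp.2.2 hp'.2.2 h
  · intro Z hZ
    rw [Finset.mem_filter, Finset.mem_powerset] at hZ
    obtain ⟨i, j, hi, hj, hij, h⟩ :=
      exists_eq_runAndPoint (by omega) hZ.1 hZ.2.1 hZ.2.2.1 hZ.2.2.2
    refine ⟨(i, j), ?_, h⟩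
    simp only [Finset.mem_offDiag, Finset.mem_range]
    omega
end

section
/- Let n ≥ 3, let 1 ≤ x ≤ n−2, and let k satisfy ⌊n/(n−x+1)⌋ ≤ k ≤ x. Then F_n(x,k) = Σ_{i=0}^{k−1} F_{n−i−1}(x−i, k) + Σ_{j=0}^{k} F_{n−k−1}(x−k, j). -/
theorem replicate_infix_iff_le_longestZeroRun (m : ℕ) (l : List Bool) :
    List.replicate m false <:+: l ↔ m ≤ longestZeroRun l := by
  unfold longestZeroRun
  constructor
  · intro h
    exact Nat.le_findGreatest (by simpa using h.length_le) h
  · intro h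
    have h0 : List.replicate (Nat.findGreatest (fun k => List.replicate k false <:+: l) l.length)
        false <:+: l :=
      Nat.findGreatest_spec (P := fun k => List.replicate k false <:+: l)
        (Nat.zero_le _) (by simp)
    refine List.IsInfix.trans ?_ h0
    exact (List.prefix_replicate_iff.2 ⟨by simpa using h, by simp⟩).isInfix

theorem replicate_prefix_replicate_append_true_cons (m i : ℕ) (w : List Bool) :
    List.replicate m false <+: List.replicate i false ++ true :: w ↔ m ≤ i := by
  induction i generalizing m with
  | zero => cases m <;> simp [List.replicate_succ, List.cons_prefix_cons]
  | succ i ih =>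
    cases m with
    | zero => simp
    | succ m => simp [List.replicate_succ, List.cons_prefix_cons, ih]

theorem replicate_infix_replicate_append_true_cons (m i : ℕ) (w : List Bool) :
    List.replicate m false <:+: List.replicate i false ++ true :: w ↔
      m ≤ i ∨ List.replicate m false <:+: w := by
  induction i with
  | zero =>
    have h := replicate_prefix_replicate_append_true_cons m 0 w
    simp only [List.replicate_zero, List.nil_append] at h ⊢
    rw [List.infix_cons_iff, h]
  | succ i ih =>
    have h := replicate_prefix_replicate_append_true_cons m (i + 1) w
    simp only [List.replicate_succ, List.cons_append] at h ⊢
    rw [List.infix_cons_iff, h, ih, ← or_assoc]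
    exact or_congr_left (by omega)

theorem longestZeroRun_replicate_append_true_cons (i : ℕ) (w : List Bool) :
    longestZeroRun (List.replicate i false ++ true :: w) = max i (longestZeroRun w) := by
  refine eq_of_forall_le_iff fun m => ?_
  rw [← replicate_infix_iff_le_longestZeroRun, replicate_infix_replicate_append_true_cons,
    replicate_infix_iff_le_longestZeroRun, le_max_iff]

open Classical in
/-- The number of binary strings of length `n` satisfying `P`. -/
noncomputable def stringCount (n : ℕ) (P : List Bool → Prop) : ℕ :=
  (Finset.univ.filter (fun s : Fin n → Bool => P (List.ofFn s))).card

theorem F_eq_stringCount (n x k : ℕ) :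
    F n x k = stringCount n (fun l => l.count false = x ∧ longestZeroRun l = k) := by
  unfold F stringCount
  congr

theorem stringCount_succ (n : ℕ) (P : List Bool → Prop) :
    stringCount (n + 1) P =
      stringCount n (fun l => P (false :: l)) + stringCount n (fun l => P (true :: l)) := by
  classical
  simp only [stringCount, Finset.card_filter]
  rw [← (Fin.consEquiv (fun _ : Fin (n + 1) => Bool)).sum_comp, Fintype.sum_prod_type,
    Fintype.sum_bool, add_comm]
  simp [Fin.consEquiv]

theorem stringCount_eq_sum_add (P : List Bool → Prop) (m r : ℕ) :
    stringCount (r + m) P =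
      ∑ i ∈ Finset.range m,
        stringCount (r + m - i - 1) (fun l => P (List.replicate i false ++ true :: l))
      + stringCount r (fun l => P (List.replicate m false ++ l)) := by
  induction m generalizing r with
  | zero => simp
  | succ m ih =>
    rw [show r + (m + 1) = r + 1 + m by ring, ih, Finset.sum_range_succ, stringCount_succ,
      show r + 1 + m - m - 1 = r by omega]
    simp only [List.replicate_succ', List.append_assoc, List.singleton_append]
    ring

theorem stringCount_congr {n : ℕ} {P Q : List Bool → Prop} (h : ∀ l, P l ↔ Q l) :
    stringCount n P = stringCount n Q := by
  rw [show P = Q from funext fun l => propext (h l)]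

theorem stringCount_eq_zero {n : ℕ} {P : List Bool → Prop} (h : ∀ l, ¬ P l) :
    stringCount n P = 0 := by
  simp [stringCount, h]

theorem sum_range_F (n x k : ℕ) :
    ∑ j ∈ Finset.range (k + 1), F n x j =
      stringCount n (fun l => l.count false = x ∧ longestZeroRun l ≤ k) := by
  classical
  unfold F stringCount
  rw [← Finset.card_biUnion]
  · congr 1
    ext s
    simp
    tauto
  · intro a _ b _ hab
    refine Finset.disjoint_left.2 fun s hs ht => hab ?_
    simp only [Finset.mem_filter] at hs ht
    exact hs.2.2.symm.trans ht.2.2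

/-- Recurrence: for `n ≥ 3`, `1 ≤ x ≤ n - 2` and `⌊n/(n-x+1)⌋ ≤ k ≤ x`,
`F n x k = ∑_{i=0}^{k-1} F (n-i-1) (x-i) k + ∑_{j=0}^{k} F (n-k-1) (x-k) j`. -/
theorem F_recurrence (n x k : ℕ) (hn : 3 ≤ n) (hx1 : 1 ≤ x) (hx2 : x ≤ n - 2)
    (hk1 : n / (n - x + 1) ≤ k) (hk2 : k ≤ x) :
    F n x k = ∑ i ∈ Finset.range k, F (n - i - 1) (x - i) k
      + ∑ j ∈ Finset.range (k + 1), F (n - k - 1) (x - k) j := by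
  obtain ⟨r, rfl⟩ : ∃ r, n = r + (k + 1) := ⟨n - (k + 1), by omega⟩
  rw [F_eq_stringCount, stringCount_eq_sum_add, Finset.sum_range_succ, sum_range_F]
  have hrun : stringCount r (fun l => (List.replicate (k + 1) false ++ l).count false = x ∧
      longestZeroRun (List.replicate (k + 1) false ++ l) = k) = 0 := by
    refine stringCount_eq_zero fun l h => ?_
    have := (replicate_infix_iff_le_longestZeroRun (k + 1) _).1
      (List.prefix_append (List.replicate (k + 1) false) l).isInfix
    omega
  rw [hrun, add_zero]
  congr 1
  · refine Finset.sum_congr rfl fun i hi => ?_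
    rw [F_eq_stringCount]
    refine stringCount_congr fun l => ?_
    have hi := Finset.mem_range.1 hi
    rw [longestZeroRun_replicate_append_true_cons]
    simp only [List.count_append, List.count_replicate_self, List.count_cons]
    simp
    omega
  · refine stringCount_congr fun l => ?_
    rw [longestZeroRun_replicate_append_true_cons]
    simp only [List.count_append, List.count_replicate_self, List.count_cons]
    simp
    omega
end

section
/- For all natural numbers n and k with 0 ≤ k ≤ n, the number of compositions of n+1 (ordered sequences of positive integers summing to n+1) whose largest summand equals k+1 is Σ_{x=0}^{n} F_n(x,k). -/
/-- The length of the initial run of zeros of a binary string, together with the lengths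
increased by one of the runs of zeros that follow each of its ones. -/
def zeroRuns : List Bool → ℕ × List ℕ
  | [] => (0, [])
  | true :: l => (0, ((zeroRuns l).1 + 1) :: (zeroRuns l).2)
  | false :: l => ((zeroRuns l).1 + 1, (zeroRuns l).2)

/-- The lengths, increased by one, of the runs of zeros (possibly empty) separated by the ones
of a binary string. -/
def runBlocks (l : List Bool) : List ℕ :=
  ((zeroRuns l).1 + 1) :: (zeroRuns l).2

theorem zeroRuns_injective : Function.Injective zeroRuns := by
  intro l
  induction l with
  | nil => rintro (_ | ⟨_ | _, l'⟩) h <;> simp_all [zeroRuns]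
  | cons a l ih =>
    rintro (_ | ⟨b, l'⟩) h
    · cases a <;> simp [zeroRuns] at h
    · have key : zeroRuns l = zeroRuns l' → l = l' := fun h => ih h
      cases a <;> cases b <;> simp_all [zeroRuns, Prod.ext_iff]

theorem runBlocks_injective : Function.Injective runBlocks := by
  intro l l' h
  simp only [runBlocks, List.cons.injEq, Nat.add_right_cancel_iff] at h
  exact zeroRuns_injective (Prod.ext h.1 h.2)

theorem sum_runBlocks (l : List Bool) : (runBlocks l).sum = l.length + 1 := by
  induction l with
  | nil => simp [runBlocks, zeroRuns]
  | cons a l ih =>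
    cases a <;> simp only [runBlocks, zeroRuns, List.sum_cons, List.length_cons] at ih ⊢ <;> omega

theorem pos_of_mem_runBlocks (l : List Bool) : ∀ i ∈ runBlocks l, 0 < i := by
  induction l with
  | nil => simp [runBlocks, zeroRuns]
  | cons a l ih => cases a <;> simp_all [runBlocks, zeroRuns]

theorem replicate_false_prefix_iff (k : ℕ) (l : List Bool) :
    List.replicate k false <+: l ↔ k ≤ (zeroRuns l).1 := by
  induction l generalizing k with
  | nil => simp [zeroRuns]
  | cons a l ih => cases k <;> cases a <;> simp [zeroRuns, List.replicate_succ, ih]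

theorem replicate_false_infix_iff (k : ℕ) (l : List Bool) :
    List.replicate k false <:+: l ↔ k + 1 ≤ (runBlocks l).foldr max 0 := by
  induction l with
  | nil => simp [runBlocks, zeroRuns]
  | cons a l ih =>
    rw [List.infix_cons_iff, replicate_false_prefix_iff, ih]
    cases a <;> simp only [runBlocks, zeroRuns, List.foldr_cons] <;> omega

theorem foldr_max_runBlocks (l : List Bool) :
    (runBlocks l).foldr max 0 = longestZeroRun l + 1 := by
  have hpos : 0 + 1 ≤ (runBlocks l).foldr max 0 := (replicate_false_infix_iff 0 l).1 (by simp)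
  have hmax : List.replicate ((runBlocks l).foldr max 0 - 1) false <:+: l :=
    (replicate_false_infix_iff _ l).2 (by omega)
  have hle : (runBlocks l).foldr max 0 - 1 ≤ longestZeroRun l :=
    Nat.le_findGreatest (by simpa using hmax.length_le) hmax
  have hspec : List.replicate (longestZeroRun l) false <:+: l :=
    Nat.findGreatest_spec (P := fun k => List.replicate k false <:+: l)
      (Nat.zero_le _) (by simp)
  have hge := (replicate_false_infix_iff _ l).1 hspec
  omega

/-- The composition of `n + 1` whose summands are the `runBlocks` of a string of length `n`. -/
def runComposition {n : ℕ} (s : Fin n → Bool) : Composition (n + 1) where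
  blocks := runBlocks (List.ofFn s)
  blocks_pos := fun {i} hi => pos_of_mem_runBlocks _ i hi
  blocks_sum := by rw [sum_runBlocks, List.length_ofFn]

theorem runComposition_bijective (n : ℕ) :
    Function.Bijective (runComposition : (Fin n → Bool) → Composition (n + 1)) := by
  rw [Fintype.bijective_iff_injective_and_card]
  refine ⟨fun s t h => ?_, by simp [composition_card]⟩
  exact List.ofFn_injective (runBlocks_injective (congrArg Composition.blocks h))

theorem sum_F (n k : ℕ) :
    ∑ x ∈ Finset.range (n + 1), F n x k =
      (Finset.univ.filter fun s : Fin n → Bool => longestZeroRun (List.ofFn s) = k).card := by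
  rw [Finset.card_eq_sum_card_fiberwise (f := fun s => (List.ofFn s).count false)
    (t := Finset.range (n + 1))]
  · refine Finset.sum_congr rfl fun x _ => ?_
    simp only [F, Finset.filter_filter, and_comm]
  · intro s _
    have := List.count_le_length (a := false) (l := List.ofFn s)
    simp only [List.length_ofFn] at this
    simpa [Nat.lt_succ_iff] using this

/-- For `k ≤ n`, the number of compositions of `n + 1` whose largest summand is
`k + 1` equals `∑_{x=0}^{n} F n x k`. -/
theorem compositions_largest_summand (n k : ℕ) (hk : k ≤ n) :
    (Finset.univ.filter (fun c : Composition (n + 1) =>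
        c.blocks.foldr max 0 = k + 1)).card
      = ∑ x ∈ Finset.range (n + 1), F n x k := by
  rw [sum_F]
  symm
  refine Finset.card_equiv (Equiv.ofBijective _ (runComposition_bijective n)) fun s => ?_
  simp [runComposition, foldr_max_runBlocks]
end
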